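/- There is an absolute constant c > 0 such that for every N ≥ 1 and every non-constant function f : {0,1}^N → {0,1}, with x uniform on {0,1}^N one has E[√(s_f^+(x))] ≥ c · Var(f) · √(log(1 + 1/Σ_{i=1}^N I_i[f]²)). In particular, if Σ_{i=1}^N I_i[f]² ≤ N^{−1/4} then E[√(s_f^+(x))] ≥ c · Var(f) · √(log N). -/

import Mathlib

/-- Expectation of `g` with respect to the uniform measure on `{0,1}^N`. -/
noncomputable def cubeE (N : ℕ) (g : (Fin N → Bool) → ℝ) : ℝ :=
  (∑ x : Fin N → Bool, g x) / 2 ^ N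

/-- The real value of a Boolean. -/
def bval (b : Bool) : ℝ := if b then 1 else 0

/-- Flip the `i`-th coordinate of `x ∈ {0,1}^N`. -/
def flipCoord {N : ℕ} (x : Fin N → Bool) (i : Fin N) : Fin N → Bool :=
  Function.update x i (!x i)

/-- The influence `I_i[f] = P[f(x) ≠ f(x ⊕ eᵢ)]`, `x` uniform on `{0,1}^N`. -/
noncomputable def influence {N : ℕ} (f : (Fin N → Bool) → Bool) (i : Fin N) : ℝ :=
  (Nat.card {x : Fin N → Bool // f x ≠ f (flipCoord x i)} : ℝ) / 2 ^ N

/-- The positive sensitivity `s_f⁺(x)`: `0` if `f(x) = 1`, otherwise the number of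
coordinates `i` with `f(x ⊕ eᵢ) = 1`. -/
noncomputable def posSens {N : ℕ} (f : (Fin N → Bool) → Bool) (x : Fin N → Bool) : ℕ :=
  if f x then 0 else Nat.card {i : Fin N // f (flipCoord x i) = true}

/-- The variance of `f(x)`, `x` uniform on `{0,1}^N`. -/
noncomputable def bvar {N : ℕ} (f : (Fin N → Bool) → Bool) : ℝ :=
  cubeE N (fun x => (bval (f x) - cubeE N (fun y => bval (f y))) ^ 2)

/-! ### Expectation over the cube -/

section Expectation

variable {N : ℕ}

lemma cubeE_add (g h : (Fin N → Bool) → ℝ) :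
    cubeE N (fun x => g x + h x) = cubeE N g + cubeE N h := by
  simp only [cubeE, Finset.sum_add_distrib, add_div]

lemma cubeE_sub (g h : (Fin N → Bool) → ℝ) :
    cubeE N (fun x => g x - h x) = cubeE N g - cubeE N h := by
  simp only [cubeE, Finset.sum_sub_distrib, sub_div]

lemma cubeE_const_mul (c : ℝ) (g : (Fin N → Bool) → ℝ) :
    cubeE N (fun x => c * g x) = c * cubeE N g := by
  simp only [cubeE, ← Finset.mul_sum, mul_div_assoc]

lemma cubeE_neg (g : (Fin N → Bool) → ℝ) :
    cubeE N (fun x => -g x) = -cubeE N g := by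
  simp only [cubeE, Finset.sum_neg_distrib, neg_div]

lemma cubeE_const (c : ℝ) : cubeE N (fun _ => c) = c := by
  simp [cubeE]

lemma cubeE_sum {ι : Type*} (s : Finset ι) (g : ι → (Fin N → Bool) → ℝ) :
    cubeE N (fun x => ∑ i ∈ s, g i x) = ∑ i ∈ s, cubeE N (g i) := by
  simp only [cubeE]
  rw [Finset.sum_comm, Finset.sum_div]

lemma cubeE_mono {g h : (Fin N → Bool) → ℝ} (H : ∀ x, g x ≤ h x) :
    cubeE N g ≤ cubeE N h := by
  unfold cubeE
  gcongr
  exact H _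

lemma cubeE_nonneg {g : (Fin N → Bool) → ℝ} (H : ∀ x, 0 ≤ g x) : 0 ≤ cubeE N g :=
  div_nonneg (Finset.sum_nonneg fun x _ => H x) (by positivity)

lemma cubeE_cauchySchwarz (g h : (Fin N → Bool) → ℝ) :
    cubeE N (fun x => g x * h x) ^ 2 ≤
      cubeE N (fun x => g x ^ 2) * cubeE N (fun x => h x ^ 2) := by
  simp only [cubeE]
  rw [div_mul_div_comm, div_pow, ← sq]
  gcongr
  exact Finset.sum_mul_sq_le_sq_mul_sq _ _ _

lemma flipCoord_flipCoord (x : Fin N → Bool) (i : Fin N) :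
    flipCoord (flipCoord x i) i = x := by
  simp [flipCoord]

lemma flipCoord_involutive (i : Fin N) :
    Function.Involutive fun x : Fin N → Bool => flipCoord x i :=
  fun x => flipCoord_flipCoord x i

lemma cubeE_flipCoord (g : (Fin N → Bool) → ℝ) (i : Fin N) :
    cubeE N (fun x => g (flipCoord x i)) = cubeE N g := by
  simp only [cubeE]
  congr 1
  exact Equiv.sum_comp (flipCoord_involutive i).toPerm g

end Expectation

/-! ### Characters and Fourier coefficients -/

section Fourier

variable {N : ℕ}

/-- The `i`-th coordinate of `x`, as a sign. -/
def coordSign (i : Fin N) (x : Fin N → Bool) : ℝ := if x i then -1 else 1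

/-- The Walsh character of `S`. -/
def walsh (S : Finset (Fin N)) (x : Fin N → Bool) : ℝ := ∏ i ∈ S, coordSign i x

/-- The Fourier–Walsh coefficient of `g` at `S`. -/
noncomputable def walshCoeff (g : (Fin N → Bool) → ℝ) (S : Finset (Fin N)) : ℝ :=
  cubeE N fun x => g x * walsh S x

lemma coordSign_mul_self (i : Fin N) (x : Fin N → Bool) :
    coordSign i x * coordSign i x = 1 := by
  unfold coordSign; split <;> norm_num

lemma coordSign_sq (i : Fin N) (x : Fin N → Bool) : coordSign i x ^ 2 = 1 := by
  rw [sq, coordSign_mul_self]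

lemma abs_coordSign (i : Fin N) (x : Fin N → Bool) : |coordSign i x| = 1 := by
  unfold coordSign; split <;> norm_num

lemma coordSign_flipCoord_self (i : Fin N) (x : Fin N → Bool) :
    coordSign i (flipCoord x i) = -coordSign i x := by
  unfold coordSign flipCoord; cases h : x i <;> simp

lemma coordSign_flipCoord_of_ne {i j : Fin N} (h : j ≠ i) (x : Fin N → Bool) :
    coordSign j (flipCoord x i) = coordSign j x := by
  unfold coordSign flipCoord; simp [h]

lemma walsh_flipCoord_of_notMem {S : Finset (Fin N)} {i : Fin N} (h : i ∉ S)
    (x : Fin N → Bool) : walsh S (flipCoord x i) = walsh S x :=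
  Finset.prod_congr rfl fun _ hj =>
    coordSign_flipCoord_of_ne (ne_of_mem_of_not_mem hj h) x

lemma walsh_insert {S : Finset (Fin N)} {i : Fin N} (h : i ∉ S) (x : Fin N → Bool) :
    walsh (insert i S) x = coordSign i x * walsh S x :=
  Finset.prod_insert h

lemma coordSign_mul_walsh {S : Finset (Fin N)} {i : Fin N} (h : i ∈ S) (x : Fin N → Bool) :
    coordSign i x * walsh S x = walsh (S.erase i) x := by
  rw [← Finset.insert_erase h, walsh_insert (by simp), ← mul_assoc, coordSign_mul_self]
  simp

lemma cubeE_coordSign_mul_coordSign (i j : Fin N) :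
    cubeE N (fun x => coordSign i x * coordSign j x) = if i = j then 1 else 0 := by
  split_ifs with h
  · subst h; simp only [coordSign_mul_self, cubeE_const]
  · have := cubeE_flipCoord (fun x => coordSign i x * coordSign j x) i
    simp only [coordSign_flipCoord_self, coordSign_flipCoord_of_ne (Ne.symm h), neg_mul,
      cubeE_neg] at this
    linarith

lemma sum_walsh_mul_walsh (x y : Fin N → Bool) :
    ∑ S : Finset (Fin N), walsh S x * walsh S y = if x = y then 2 ^ N else 0 := by
  have h1 : ∑ S : Finset (Fin N), walsh S x * walsh S y =
      ∏ i : Fin N, (1 + coordSign i x * coordSign i y) := by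
    rw [Finset.prod_one_add, Finset.powerset_univ]
    exact Finset.sum_congr rfl fun S _ => Finset.prod_mul_distrib.symm
  rw [h1]
  split_ifs with h
  · subst h
    simp only [coordSign_mul_self]
    norm_num
  · obtain ⟨i, hi⟩ := Function.ne_iff.mp h
    refine Finset.prod_eq_zero (Finset.mem_univ i) ?_
    unfold coordSign
    cases hx : x i <;> cases hy : y i <;> simp_all

/-- Parseval's identity. -/
lemma sum_walshCoeff_sq (g : (Fin N → Bool) → ℝ) :
    ∑ S : Finset (Fin N), walshCoeff g S ^ 2 = cubeE N fun x => g x ^ 2 := by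
  have h1 : ∀ S, walshCoeff g S ^ 2 =
      (∑ x, ∑ y, g x * g y * (walsh S x * walsh S y)) / (2 ^ N * 2 ^ N) := by
    intro S
    rw [walshCoeff, cubeE, sq, div_mul_div_comm, Finset.sum_mul_sum]
    congr 1
    exact Finset.sum_congr rfl fun x _ => Finset.sum_congr rfl fun y _ => by ring
  simp only [h1]
  rw [← Finset.sum_div, Finset.sum_comm]
  have h2 : ∀ x : Fin N → Bool,
      ∑ S : Finset (Fin N), ∑ y, g x * g y * (walsh S x * walsh S y) = 2 ^ N * g x ^ 2 := by
    intro x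
    rw [Finset.sum_comm]
    simp only [← Finset.mul_sum, sum_walsh_mul_walsh]
    simp
    ring
  simp only [h2, cubeE]
  rw [← Finset.mul_sum, mul_div_mul_left _ _ (by positivity)]

lemma walshCoeff_empty (g : (Fin N → Bool) → ℝ) : walshCoeff g ∅ = cubeE N g := by
  simp [walshCoeff, walsh]

end Fourier

/-! ### Hypercontractivity -/

section Hypercontractivity

variable {N : ℕ}

/-- Bonami's inequality for polynomials on the cube. -/
lemma cubeE_pow_four_le (U : Finset (Fin N)) (a : Finset (Fin N) → ℝ) :
    cubeE N (fun x => (∑ S ∈ U.powerset, a S * walsh S x) ^ 4) ≤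
      (∑ S ∈ U.powerset, 3 ^ S.card * a S ^ 2) ^ 2 := by
  induction U using Finset.induction_on generalizing a with
  | empty => simp [walsh, cubeE_const]; exact le_of_eq (by ring)
  | insert i U hi ih =>
    set P : (Fin N → Bool) → ℝ := fun x => ∑ S ∈ U.powerset, a S * walsh S x with hP
    set Q : (Fin N → Bool) → ℝ := fun x => ∑ S ∈ U.powerset, a (insert i S) * walsh S x with hQ
    have hnot : ∀ S ∈ U.powerset, i ∉ S := fun S hS h => hi (Finset.mem_powerset.mp hS h)
    have hPflip : ∀ x, P (flipCoord x i) = P x := fun x =>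
      Finset.sum_congr rfl fun S hS => by rw [walsh_flipCoord_of_notMem (hnot S hS)]
    have hQflip : ∀ x, Q (flipCoord x i) = Q x := fun x =>
      Finset.sum_congr rfl fun S hS => by rw [walsh_flipCoord_of_notMem (hnot S hS)]
    have hsplit : ∀ x, ∑ S ∈ (insert i U).powerset, a S * walsh S x =
        P x + coordSign i x * Q x := by
      intro x
      rw [Finset.sum_powerset_insert hi, hP, hQ, Finset.mul_sum]
      congr 1
      exact Finset.sum_congr rfl fun S hS => by rw [walsh_insert (hnot S hS)]; ring
    have hsplit' : ∑ S ∈ (insert i U).powerset, 3 ^ S.card * a S ^ 2 =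
        ∑ S ∈ U.powerset, 3 ^ S.card * a S ^ 2 +
          3 * ∑ S ∈ U.powerset, 3 ^ S.card * a (insert i S) ^ 2 := by
      rw [Finset.sum_powerset_insert hi, Finset.mul_sum]
      congr 1
      exact Finset.sum_congr rfl fun S hS => by
        rw [Finset.card_insert_of_notMem (hnot S hS)]; ring
    have hexp : cubeE N (fun x => (P x + coordSign i x * Q x) ^ 4) =
        cubeE N (fun x => P x ^ 4) + 6 * cubeE N (fun x => P x ^ 2 * Q x ^ 2) +
          cubeE N (fun x => Q x ^ 4) := by
      have h1 := cubeE_flipCoord (fun x => (P x + coordSign i x * Q x) ^ 4) i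
      simp only [hPflip, hQflip, coordSign_flipCoord_self] at h1
      have h2 : cubeE N (fun x => (P x + coordSign i x * Q x) ^ 4) +
          cubeE N (fun x => (P x + -coordSign i x * Q x) ^ 4) =
          2 * (cubeE N (fun x => P x ^ 4) + 6 * cubeE N (fun x => P x ^ 2 * Q x ^ 2) +
          cubeE N (fun x => Q x ^ 4)) := by
        rw [← cubeE_const_mul, ← cubeE_add, ← cubeE_add, ← cubeE_add, ← cubeE_const_mul]
        congr 1
        ext x
        have e := coordSign_sq i x
        have e4 : coordSign i x ^ 4 = 1 := by
          rw [show coordSign i x ^ 4 = (coordSign i x ^ 2) ^ 2 by ring, e]; norm_num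
        linear_combination (12 * P x ^ 2 * Q x ^ 2) * e + 2 * Q x ^ 4 * e4
      linarith
    have hPi := ih a
    have hQi := ih fun S => a (insert i S)
    have hcs := cubeE_cauchySchwarz (fun x => P x ^ 2) (fun x => Q x ^ 2)
    simp only [← pow_mul] at hcs
    norm_num at hcs
    simp only [hsplit]
    rw [hexp, hsplit']
    change cubeE N (fun x => P x ^ 4) ≤ _ at hPi
    change cubeE N (fun x => Q x ^ 4) ≤ _ at hQi
    set p := cubeE N fun x => P x ^ 4
    set q := cubeE N fun x => Q x ^ 4
    set r := cubeE N fun x => P x ^ 2 * Q x ^ 2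
    set A := ∑ S ∈ U.powerset, 3 ^ S.card * a S ^ 2
    set B := ∑ S ∈ U.powerset, 3 ^ S.card * a (insert i S) ^ 2
    have hA : 0 ≤ A := Finset.sum_nonneg fun S _ => by positivity
    have hB : 0 ≤ B := Finset.sum_nonneg fun S _ => by positivity
    have hq : 0 ≤ q := cubeE_nonneg fun x => by positivity
    have hr : r ≤ A * B := by
      refine abs_le_of_sq_le_sq' ?_ (by positivity) |>.2
      calc r ^ 2 ≤ p * q := hcs
        _ ≤ A ^ 2 * B ^ 2 := by gcongr
        _ = (A * B) ^ 2 := by ring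
    nlinarith [sq_nonneg B]

/-- The `L¹`–`L²` form of hypercontractivity. -/
lemma sum_walshCoeff_sq_div_le (g : (Fin N → Bool) → ℝ) :
    ∑ S : Finset (Fin N), walshCoeff g S ^ 2 / 3 ^ S.card ≤
      cubeE N (fun x => |g x|) * √(cubeE N fun x => g x ^ 2) := by
  set H := ∑ S : Finset (Fin N), walshCoeff g S ^ 2 / 3 ^ S.card with hH
  set p : (Fin N → Bool) → ℝ := fun x =>
    ∑ S : Finset (Fin N), walshCoeff g S / 3 ^ S.card * walsh S x with hp
  have hH0 : 0 ≤ H := Finset.sum_nonneg fun S _ => by positivity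
  have hgp : cubeE N (fun x => g x * p x) = H := by
    simp only [hp, Finset.mul_sum]
    rw [cubeE_sum]
    refine Finset.sum_congr rfl fun S _ => ?_
    rw [sq, mul_div_right_comm, walshCoeff, ← cubeE_const_mul]
    congr 1
    ext x
    ring
  have hp4 : cubeE N (fun x => p x ^ 4) ≤ H ^ 2 := by
    have := cubeE_pow_four_le Finset.univ fun S => walshCoeff g S / 3 ^ S.card
    rw [Finset.powerset_univ] at this
    refine this.trans (le_of_eq ?_)
    congr 1
    refine Finset.sum_congr rfl fun S _ => ?_
    field_simp
  set u := cubeE N fun x => |g x|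
  set w := cubeE N fun x => g x ^ 2
  have hu : 0 ≤ u := cubeE_nonneg fun x => abs_nonneg _
  have hw : 0 ≤ w := cubeE_nonneg fun x => sq_nonneg _
  set t := cubeE N fun x => |g x| * p x ^ 2
  have ht : 0 ≤ t := cubeE_nonneg fun x => by positivity
  have h1 : H ^ 2 ≤ u * t := by
    have := cubeE_cauchySchwarz (fun x => √|g x|) (fun x => √|g x| * |p x|)
    simp only [mul_pow, Real.sq_sqrt (abs_nonneg _), sq_abs] at this
    refine le_trans ?_ this
    gcongr
    rw [← hgp]
    refine cubeE_mono fun x => ?_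
    rw [← mul_assoc, Real.mul_self_sqrt (abs_nonneg _), ← abs_mul]
    exact le_abs_self _
  have h2 : t ^ 2 ≤ w * H ^ 2 := by
    have := cubeE_cauchySchwarz (fun x => |g x|) (fun x => p x ^ 2)
    simp only [← pow_mul, sq_abs] at this
    exact this.trans (by gcongr)
  have h3 : t ≤ √w * H := by
    refine abs_le_of_sq_le_sq' ?_ (by positivity) |>.2
    rwa [mul_pow, Real.sq_sqrt hw]
  rcases hH0.eq_or_lt with h0 | h0
  · rw [← h0]; positivity
  · have : H * H ≤ (u * √w) * H := by
      calc H * H = H ^ 2 := by ring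
        _ ≤ u * t := h1
        _ ≤ u * (√w * H) := by gcongr
        _ = _ := by ring
    exact le_of_mul_le_mul_right this h0

end Hypercontractivity

/-! ### Averaging over a set of coordinates -/

section Averaging

variable {N : ℕ}

/-- The point agreeing with `y` on `I` and with `x` off `I`. -/
def mixCoord (I : Finset (Fin N)) (x y : Fin N → Bool) : Fin N → Bool :=
  fun i => if i ∈ I then y i else x i

/-- The average of `g` over the coordinates in `I`. -/
noncomputable def coordAvg (I : Finset (Fin N)) (g : (Fin N → Bool) → ℝ)
    (x : Fin N → Bool) : ℝ :=
  cubeE N fun y => g (mixCoord I x y)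

/-- The level-one Fourier coefficient at `i` of the restriction of `g` to the subcube through `x`
in the directions of `I`. -/
noncomputable def levelOne (I : Finset (Fin N)) (g : (Fin N → Bool) → ℝ) (i : Fin N)
    (x : Fin N → Bool) : ℝ :=
  coordAvg I (fun z => g z * coordSign i z) x

lemma mixCoord_mixCoord (I : Finset (Fin N)) (x y z : Fin N → Bool) :
    mixCoord I (mixCoord I x y) z = mixCoord I x z := by
  ext i; simp only [mixCoord]; split <;> rfl

lemma mixCoord_flipCoord {I : Finset (Fin N)} {i : Fin N} (hi : i ∈ I) (x : Fin N → Bool) :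
    mixCoord I x (flipCoord x i) = flipCoord x i := by
  ext j
  by_cases hj : j ∈ I
  · simp [mixCoord, hj]
  · have : j ≠ i := fun e => hj (e ▸ hi)
    simp [mixCoord, hj, flipCoord, this]

lemma coordSign_mixCoord {I : Finset (Fin N)} {i : Fin N} (hi : i ∈ I) (x y : Fin N → Bool) :
    coordSign i (mixCoord I x y) = coordSign i y := by
  simp [coordSign, mixCoord, hi]

lemma walsh_mixCoord {I S : Finset (Fin N)} (h : ∀ j ∈ S, j ∉ I) (x y : Fin N → Bool) :
    walsh S (mixCoord I x y) = walsh S x :=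
  Finset.prod_congr rfl fun j hj => by simp [coordSign, mixCoord, h j hj]

lemma cubeE_coordAvg (I : Finset (Fin N)) (g : (Fin N → Bool) → ℝ) :
    cubeE N (coordAvg I g) = cubeE N g := by
  let e : (Fin N → Bool) × (Fin N → Bool) → (Fin N → Bool) × (Fin N → Bool) :=
    fun p => (mixCoord I p.1 p.2, mixCoord I p.2 p.1)
  have he : Function.Involutive e := by
    rintro ⟨x, y⟩
    ext i <;> simp only [e, mixCoord] <;> split <;> rfl
  have h := Equiv.sum_comp he.toPerm fun p => g p.1
  rw [Fintype.sum_prod_type, Fintype.sum_prod_type] at h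
  simp only [coordAvg, cubeE, ← Finset.sum_div]
  rw [div_div, div_eq_div_iff (by positivity) (by positivity)]
  change ∑ x, ∑ y, g (mixCoord I x y) = _ at h
  rw [h]
  simp [← Finset.mul_sum]
  ring

lemma coordAvg_mul_left {I : Finset (Fin N)} {u : (Fin N → Bool) → ℝ}
    (hu : ∀ x y, u (mixCoord I x y) = u x) (g : (Fin N → Bool) → ℝ) (x : Fin N → Bool) :
    coordAvg I (fun z => u z * g z) x = u x * coordAvg I g x := by
  simp only [coordAvg, hu, cubeE_const_mul]

lemma levelOne_mixCoord (I : Finset (Fin N)) (g : (Fin N → Bool) → ℝ) (i : Fin N)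
    (x y : Fin N → Bool) : levelOne I g i (mixCoord I x y) = levelOne I g i x := by
  simp only [levelOne, coordAvg, mixCoord_mixCoord]

lemma cubeE_mul_levelOne {I : Finset (Fin N)} {u : (Fin N → Bool) → ℝ}
    (hu : ∀ x y, u (mixCoord I x y) = u x) (g : (Fin N → Bool) → ℝ) (i : Fin N) :
    cubeE N (fun x => u x * levelOne I g i x) =
      cubeE N (fun x => u x * (g x * coordSign i x)) := by
  rw [← cubeE_coordAvg I fun x => u x * (g x * coordSign i x)]
  congr 1
  ext x
  rw [coordAvg_mul_left hu, levelOne]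

/-- Bessel's inequality on subcubes. -/
lemma sum_levelOne_sq_le (I : Finset (Fin N)) (g : (Fin N → Bool) → ℝ) (x : Fin N → Bool) :
    ∑ i ∈ I, levelOne I g i x ^ 2 ≤ coordAvg I (fun z => g z ^ 2) x := by
  set a : Fin N → ℝ := fun i => levelOne I g i x with ha
  have hcross : cubeE N (fun y => g (mixCoord I x y) * ∑ i ∈ I, a i * coordSign i y) =
      ∑ i ∈ I, a i ^ 2 := by
    simp only [Finset.mul_sum]
    rw [cubeE_sum]
    refine Finset.sum_congr rfl fun i hi => ?_
    rw [sq]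
    nth_rw 2 [ha]
    simp only [levelOne, coordAvg]
    rw [mul_comm, ← cubeE_const_mul]
    congr 1
    ext y
    rw [coordSign_mixCoord hi]
    ring
  have hsq : cubeE N (fun y => (∑ i ∈ I, a i * coordSign i y) ^ 2) = ∑ i ∈ I, a i ^ 2 := by
    simp only [sq, Finset.sum_mul_sum]
    rw [cubeE_sum]
    refine Finset.sum_congr rfl fun i hi => ?_
    rw [cubeE_sum]
    have : ∀ j, cubeE N (fun y => a i * coordSign i y * (a j * coordSign j y)) =
        if i = j then a i * a j else 0 := by
      intro j
      rw [← mul_ite_zero, ← mul_one (a j), ← mul_ite_zero, ← cubeE_coordSign_mul_coordSign,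
        ← cubeE_const_mul, ← cubeE_const_mul]
      congr 1
      ext y
      ring
    simp [this, hi]
  have h0 : 0 ≤ cubeE N fun y => (g (mixCoord I x y) - ∑ i ∈ I, a i * coordSign i y) ^ 2 :=
    cubeE_nonneg fun y => sq_nonneg _
  have h1 : cubeE N (fun y => (g (mixCoord I x y) - ∑ i ∈ I, a i * coordSign i y) ^ 2) =
      coordAvg I (fun z => g z ^ 2) x -
        2 * cubeE N (fun y => g (mixCoord I x y) * ∑ i ∈ I, a i * coordSign i y) +
        cubeE N (fun y => (∑ i ∈ I, a i * coordSign i y) ^ 2) := by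
    rw [coordAvg, ← cubeE_const_mul, ← cubeE_sub, ← cubeE_add]
    congr 1
    ext y
    ring
  rw [hcross, hsq] at h1
  change ∑ i ∈ I, a i ^ 2 ≤ _
  linarith

lemma walshCoeff_coordSign_mul_levelOne {I S : Finset (Fin N)} {i : Fin N} (hS : i ∈ S)
    (h : ∀ j ∈ S, j ∈ I → j = i) (g : (Fin N → Bool) → ℝ) :
    walshCoeff (fun x => coordSign i x * levelOne I g i x) S = walshCoeff g S := by
  have hu : ∀ x y, walsh (S.erase i) (mixCoord I x y) = walsh (S.erase i) x :=
    walsh_mixCoord fun j hj hjI =>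
      Finset.ne_of_mem_erase hj (h j (Finset.mem_of_mem_erase hj) hjI)
  have h1 : walshCoeff (fun x => coordSign i x * levelOne I g i x) S =
      cubeE N (fun x => walsh (S.erase i) x * levelOne I g i x) := by
    rw [walshCoeff]
    congr 1
    ext x
    rw [← coordSign_mul_walsh hS]
    ring
  rw [h1, cubeE_mul_levelOne hu, walshCoeff]
  congr 1
  ext x
  rw [← coordSign_mul_walsh hS]
  linear_combination (g x * walsh S x) * coordSign_mul_self i x

end Averaging

/-! ### Boolean functions -/

section Boolean

variable {N : ℕ}

/-- The centred real-valued version of a Boolean function. -/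
noncomputable def centered (f : (Fin N → Bool) → Bool) (x : Fin N → Bool) : ℝ :=
  bval (f x) - cubeE N fun y => bval (f y)

/-- The `i`-th coordinate of the gradient, kept only at points where `f` vanishes. -/
def upEdge (f : (Fin N → Bool) → Bool) (i : Fin N) (x : Fin N → Bool) : ℝ :=
  if f x = false ∧ f (flipCoord x i) = true then coordSign i x else 0

lemma bvar_eq (f : (Fin N → Bool) → Bool) : bvar f = cubeE N fun x => centered f x ^ 2 := rfl

lemma bvar_nonneg (f : (Fin N → Bool) → Bool) : 0 ≤ bvar f :=
  cubeE_nonneg fun _ => sq_nonneg _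

lemma bval_nonneg (b : Bool) : 0 ≤ bval b := by unfold bval; split <;> norm_num

lemma bval_le_one (b : Bool) : bval b ≤ 1 := by unfold bval; split <;> norm_num

lemma cubeE_bval_nonneg (f : (Fin N → Bool) → Bool) : 0 ≤ cubeE N fun x => bval (f x) :=
  cubeE_nonneg fun _ => bval_nonneg _

lemma cubeE_bval_le_one (f : (Fin N → Bool) → Bool) : cubeE N (fun x => bval (f x)) ≤ 1 :=
  (cubeE_mono fun _ => bval_le_one _).trans_eq (cubeE_const 1)

lemma centered_sq_le_one (f : (Fin N → Bool) → Bool) (x : Fin N → Bool) :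
    centered f x ^ 2 ≤ 1 := by
  rw [sq_le_one_iff_abs_le_one, abs_le, centered]
  constructor <;>
  linarith [bval_nonneg (f x), bval_le_one (f x), cubeE_bval_nonneg f, cubeE_bval_le_one f]

lemma cubeE_centered (f : (Fin N → Bool) → Bool) : cubeE N (centered f) = 0 := by
  unfold centered
  rw [cubeE_sub, cubeE_const, sub_self]

lemma cubeE_abs_centered (f : (Fin N → Bool) → Bool) :
    cubeE N (fun x => |centered f x|) = 2 * bvar f := by
  set μ := cubeE N fun y => bval (f y) with hμ
  have h0 := cubeE_bval_nonneg f
  have h1 := cubeE_bval_le_one f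
  have e1 : cubeE N (fun x => |centered f x|) =
      μ + cubeE N (fun x => (1 - 2 * μ) * bval (f x)) := by
    rw [← cubeE_const (N := N) μ, ← cubeE_add]
    congr 1
    ext x
    rw [cubeE_const, centered, ← hμ]
    cases f x
    · simp only [bval, Bool.false_eq_true, if_false, mul_zero, add_zero, zero_sub, abs_neg]
      exact abs_of_nonneg h0
    · simp only [bval, if_true]
      rw [abs_of_nonneg (by linarith)]
      ring
  have e2 : bvar f = μ ^ 2 + cubeE N (fun x => (1 - 2 * μ) * bval (f x)) := by
    rw [bvar_eq, ← cubeE_const (N := N) (μ ^ 2), ← cubeE_add]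
    congr 1
    ext x
    rw [centered, ← hμ]
    cases f x
    · simp [bval]
    · simp only [bval, if_true]
      ring
  rw [e1, e2, cubeE_const_mul]
  ring

lemma sum_upEdge_sq (f : (Fin N → Bool) → Bool) (x : Fin N → Bool) :
    ∑ i, upEdge f i x ^ 2 = posSens f x := by
  unfold posSens upEdge
  cases hx : f x
  · simp only [ite_pow, coordSign_sq]
    simp [Nat.card_eq_fintype_card, Fintype.card_subtype]
  · simp

lemma cubeE_abs_upEdge (f : (Fin N → Bool) → Bool) (i : Fin N) :
    cubeE N (fun x => |upEdge f i x|) = influence f i / 2 := by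
  have h1 := cubeE_flipCoord (fun x => |upEdge f i x|) i
  have h2 : influence f i = cubeE N (fun x => |upEdge f i x|) +
      cubeE N (fun x => |upEdge f i (flipCoord x i)|) := by
    rw [← cubeE_add, influence, cubeE, Nat.card_eq_fintype_card, Fintype.card_subtype]
    congr 1
    rw [Finset.card_filter, Nat.cast_sum]
    refine Finset.sum_congr rfl fun x _ => ?_
    simp only [upEdge, flipCoord_flipCoord]
    cases f x <;> cases f (flipCoord x i) <;> simp [abs_coordSign]
  linarith

lemma cubeE_mul_levelOne_centered {I : Finset (Fin N)} {i : Fin N} (hi : i ∈ I)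
    {u : (Fin N → Bool) → ℝ} (hu : ∀ x y, u (mixCoord I x y) = u x)
    (f : (Fin N → Bool) → Bool) :
    cubeE N (fun x => u x * levelOne I (centered f) i x) =
      -cubeE N (fun x => u x * upEdge f i x) := by
  have hflip : ∀ x, u (flipCoord x i) = u x := fun x => by
    rw [← mixCoord_flipCoord hi, hu]
  rw [cubeE_mul_levelOne hu]
  have h1 := cubeE_flipCoord (fun x => u x * (centered f x * coordSign i x)) i
  have h2 := cubeE_flipCoord (fun x => u x * upEdge f i x) i
  have h3 : cubeE N (fun x => u x * (centered f x * coordSign i x)) +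
      cubeE N (fun x => u (flipCoord x i) *
        (centered f (flipCoord x i) * coordSign i (flipCoord x i))) =
      -(cubeE N (fun x => u x * upEdge f i x) +
        cubeE N (fun x => u (flipCoord x i) * upEdge f i (flipCoord x i))) := by
    rw [← cubeE_add, ← cubeE_add, ← cubeE_neg]
    congr 1
    ext x
    simp only [hflip, upEdge, flipCoord_flipCoord, coordSign_flipCoord_self, centered]
    cases f x <;> cases f (flipCoord x i) <;> simp [bval] <;> ring
  linarith

lemma cubeE_abs_levelOne_le {I : Finset (Fin N)} {i : Fin N} (hi : i ∈ I)
    (f : (Fin N → Bool) → Bool) :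
    cubeE N (fun x => |levelOne I (centered f) i x|) ≤ influence f i / 2 := by
  have h := cubeE_mul_levelOne_centered hi
    (u := fun x => SignType.sign (levelOne I (centered f) i x))
    (fun x y => by simp only [levelOne_mixCoord]) f
  simp only [sign_mul_self] at h
  rw [h, ← cubeE_abs_upEdge, ← cubeE_neg]
  refine cubeE_mono fun x => ?_
  refine (neg_le_abs _).trans ?_
  rw [abs_mul]
  refine mul_le_of_le_one_left (abs_nonneg _) ?_
  rcases SignType.trichotomy (SignType.sign (levelOne I (centered f) i x)) with h | h | h <;>
    simp [h]

end Boolean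

/-! ### Colourings of the coordinates -/

section Colouring

variable {N : ℕ} {α : Type*} [DecidableEq α]

/-- The set of coordinates with the same colour as `i`. -/
def sameColour (κ : Fin N → α) (i : Fin N) : Finset (Fin N) :=
  Finset.univ.filter fun j => κ j = κ i

/-- The elements of `S` whose colour is not repeated in `S`. -/
def isolated (κ : Fin N → α) (S : Finset (Fin N)) : Finset (Fin N) :=
  S.filter fun i => ∀ j ∈ S, κ j = κ i → j = i

lemma mem_sameColour_self (κ : Fin N → α) (i : Fin N) : i ∈ sameColour κ i := by
  simp [sameColour]

lemma sum_walshCoeff_sq_mul_card_isolated_le (κ : Fin N → α) (g : (Fin N → Bool) → ℝ)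
    {w : Finset (Fin N) → ℝ} (hw : ∀ S, 0 ≤ w S) :
    ∑ S, walshCoeff g S ^ 2 * w S * (isolated κ S).card ≤
      ∑ i, ∑ S, walshCoeff (fun x => coordSign i x * levelOne (sameColour κ i) g i x) S ^ 2
        * w S := by
  rw [Finset.sum_comm]
  refine Finset.sum_le_sum fun S _ => ?_
  rw [Finset.cast_card, Finset.mul_sum]
  refine le_trans (Finset.sum_le_sum fun i hi => ?_)
    (Finset.sum_le_sum_of_subset_of_nonneg (Finset.subset_univ (isolated κ S)) fun i _ _ =>
      mul_nonneg (sq_nonneg _) (hw S))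
  rw [isolated, Finset.mem_filter] at hi
  rw [walshCoeff_coordSign_mul_levelOne hi.1 fun j hj hjI =>
    hi.2 j hj (by simpa [sameColour] using hjI), mul_one]

variable [Fintype α]

lemma sum_levelOne_sameColour_sq_le (κ : Fin N → α) (g : (Fin N → Bool) → ℝ)
    (x : Fin N → Bool) :
    ∑ i, levelOne (sameColour κ i) g i x ^ 2 ≤
      ∑ c, coordAvg (Finset.univ.filter fun j => κ j = c) (fun z => g z ^ 2) x := by
  rw [← Finset.sum_fiberwise Finset.univ κ]
  refine Finset.sum_le_sum fun c _ => ?_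
  refine le_trans (le_of_eq ?_) (sum_levelOne_sq_le _ _ _)
  refine Finset.sum_congr rfl fun i hi => ?_
  rw [Finset.mem_filter] at hi
  rw [sameColour, hi.2]

lemma sum_cubeE_levelOne_sq_le_bvar (κ : Fin N → α) (f : (Fin N → Bool) → Bool) :
    ∑ i, cubeE N (fun x => levelOne (sameColour κ i) (centered f) i x ^ 2) ≤
      Fintype.card α * bvar f := by
  rw [← cubeE_sum]
  refine (cubeE_mono (sum_levelOne_sameColour_sq_le κ (centered f))).trans (le_of_eq ?_)
  rw [cubeE_sum]
  simp only [cubeE_coordAvg]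
  simp [bvar_eq]

lemma sum_cubeE_levelOne_sq_le_posSens (κ : Fin N → α) (f : (Fin N → Bool) → Bool) :
    ∑ i, cubeE N (fun x => levelOne (sameColour κ i) (centered f) i x ^ 2) ≤
      √(Fintype.card α) * cubeE N (fun x => √(posSens f x)) := by
  set F : Fin N → (Fin N → Bool) → ℝ := fun i x => levelOne (sameColour κ i) (centered f) i x
    with hF
  have hbound : ∀ x, ∑ i, F i x ^ 2 ≤ Fintype.card α := by
    intro x
    refine (sum_levelOne_sameColour_sq_le κ (centered f) x).trans ?_
    refine (Finset.sum_le_card_nsmul _ _ 1 fun c _ => ?_).trans (by simp)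
    exact (cubeE_mono fun y => centered_sq_le_one f _).trans_eq (cubeE_const 1)
  have h1 : ∀ i, cubeE N (fun x => F i x ^ 2) = cubeE N (fun x => -F i x * upEdge f i x) := by
    intro i
    simp only [neg_mul, cubeE_neg, sq]
    exact cubeE_mul_levelOne_centered (mem_sameColour_self κ i)
      (fun x y => levelOne_mixCoord _ _ _ x y) f
  change ∑ i, cubeE N (fun x => F i x ^ 2) ≤ _
  simp only [h1]
  rw [← cubeE_sum, ← cubeE_const_mul]
  refine cubeE_mono fun x => ?_
  refine (Real.sum_mul_le_sqrt_mul_sqrt _ _ _).trans ?_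
  rw [sum_upEdge_sq]
  simp only [neg_sq]
  gcongr
  exact hbound x

lemma sum_cubeE_abs_levelOne_mul_le (κ : Fin N → α) (f : (Fin N → Bool) → Bool) :
    ∑ i, cubeE N (fun x => |levelOne (sameColour κ i) (centered f) i x|) *
        √(cubeE N fun x => levelOne (sameColour κ i) (centered f) i x ^ 2) ≤
      √(∑ i, influence f i ^ 2) * √(Fintype.card α * bvar f) := by
  refine (Real.sum_mul_le_sqrt_mul_sqrt _ _ _).trans ?_
  have h0 : ∀ i, 0 ≤ cubeE N (fun x => |levelOne (sameColour κ i) (centered f) i x|) :=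
    fun i => cubeE_nonneg fun x => abs_nonneg _
  refine mul_le_mul (Real.sqrt_le_sqrt (Finset.sum_le_sum fun i _ => ?_))
    (Real.sqrt_le_sqrt ?_) (Real.sqrt_nonneg _) (Real.sqrt_nonneg _)
  · refine pow_le_pow_left₀ (h0 i) ?_ 2
    have h1 := cubeE_abs_levelOne_le (mem_sameColour_self κ i) f
    linarith [h0 i]
  · refine le_trans (le_of_eq ?_) (sum_cubeE_levelOne_sq_le_bvar κ f)
    exact Finset.sum_congr rfl fun i _ => Real.sq_sqrt (cubeE_nonneg fun x => sq_nonneg _)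

lemma sum_walshCoeff_sq_mul_card_isolated_le_posSens (κ : Fin N → α)
    (f : (Fin N → Bool) → Bool) :
    ∑ S, walshCoeff (centered f) S ^ 2 * (isolated κ S).card ≤
      √(Fintype.card α) * cubeE N (fun x => √(posSens f x)) := by
  have h := sum_walshCoeff_sq_mul_card_isolated_le κ (centered f) (w := fun _ => 1)
    fun _ => zero_le_one
  simp only [mul_one, sum_walshCoeff_sq, mul_pow, coordSign_sq, one_mul] at h
  exact h.trans (sum_cubeE_levelOne_sq_le_posSens κ f)

lemma sum_walshCoeff_sq_div_mul_card_isolated_le (κ : Fin N → α)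
    (f : (Fin N → Bool) → Bool) :
    ∑ S, walshCoeff (centered f) S ^ 2 / 3 ^ S.card * (isolated κ S).card ≤
      √(∑ i, influence f i ^ 2) * √(Fintype.card α * bvar f) := by
  have h := sum_walshCoeff_sq_mul_card_isolated_le κ (centered f)
    (w := fun S => (3 ^ S.card)⁻¹) fun _ => by positivity
  simp only [← div_eq_mul_inv] at h
  refine h.trans ((Finset.sum_le_sum fun i _ => sum_walshCoeff_sq_div_le _).trans ?_)
  simp only [mul_pow, coordSign_sq, one_mul, abs_mul, abs_coordSign]
  exact sum_cubeE_abs_levelOne_mul_le κ f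

end Colouring

section RandomColouring

variable {N m : ℕ} [NeZero m]

lemma mul_sum_colouring_eq {i j : Fin N} (h : j ≠ i) :
    (m : ℝ) * ∑ κ : Fin N → ZMod m, (if κ j = κ i then (1 : ℝ) else 0) =
      (Fintype.card (Fin N → ZMod m) : ℝ) := by
  have hshift : ∀ t : ZMod m, ∑ κ : Fin N → ZMod m, (if κ j = κ i then (1 : ℝ) else 0) =
      ∑ κ : Fin N → ZMod m, (if κ j = κ i + t then (1 : ℝ) else 0) := by
    intro t
    rw [← Equiv.sum_comp (Equiv.addRight (Pi.single i t))]
    simp [h]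
  calc (m : ℝ) * ∑ κ : Fin N → ZMod m, (if κ j = κ i then (1 : ℝ) else 0)
      = ∑ t : ZMod m, ∑ κ : Fin N → ZMod m, (if κ j = κ i + t then (1 : ℝ) else 0) := by
        simp only [← hshift]
        simp [ZMod.card]
    _ = ∑ κ : Fin N → ZMod m, ∑ t : ZMod m, (if t = κ j - κ i then (1 : ℝ) else 0) := by
        rw [Finset.sum_comm]
        simp only [eq_sub_iff_add_eq', eq_comm]
    _ = (Fintype.card (Fin N → ZMod m) : ℝ) := by simp

lemma le_sum_card_isolated {S : Finset (Fin N)} (hS : 2 * S.card ≤ m) :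
    (Fintype.card (Fin N → ZMod m) : ℝ) * (S.card / 2) ≤
      ∑ κ : Fin N → ZMod m, ((isolated κ S).card : ℝ) := by
  set M : ℝ := (Fintype.card (Fin N → ZMod m) : ℝ) with hM
  have hM0 : 0 ≤ M := Nat.cast_nonneg _
  have hm : (0 : ℝ) < m := Nat.cast_pos.mpr (NeZero.pos m)
  have hS' : 2 * (S.card : ℝ) ≤ m := by exact_mod_cast hS
  have hpt : ∀ κ : Fin N → ZMod m, ∑ i ∈ S, (1 - ∑ j ∈ S.erase i,
      (if κ j = κ i then (1 : ℝ) else 0)) ≤ (isolated κ S).card := by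
    intro κ
    rw [isolated, Finset.card_filter, Nat.cast_sum]
    refine Finset.sum_le_sum fun i _ => ?_
    split_ifs with h
    · have : 0 ≤ ∑ j ∈ S.erase i, (if κ j = κ i then (1 : ℝ) else 0) :=
        Finset.sum_nonneg fun j _ => by split <;> norm_num
      push_cast
      linarith
    · push Not at h
      obtain ⟨j, hj, hκ, hji⟩ := h
      have : (if κ j = κ i then (1 : ℝ) else 0) ≤
          ∑ j ∈ S.erase i, (if κ j = κ i then (1 : ℝ) else 0) :=
        Finset.single_le_sum (f := fun j => if κ j = κ i then (1 : ℝ) else 0)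
          (fun j _ => by split <;> norm_num) (Finset.mem_erase.mpr ⟨hji, hj⟩)
      rw [if_pos hκ] at this
      push_cast
      linarith
  refine le_trans ?_ (Finset.sum_le_sum fun κ _ => hpt κ)
  rw [Finset.sum_comm]
  have hi : ∀ i ∈ S, M / 2 ≤ ∑ κ : Fin N → ZMod m, (1 - ∑ j ∈ S.erase i,
      (if κ j = κ i then (1 : ℝ) else 0)) := by
    intro i _
    rw [Finset.sum_sub_distrib, Finset.sum_comm]
    have hj : ∀ j ∈ S.erase i, ∑ κ : Fin N → ZMod m, (if κ j = κ i then (1 : ℝ) else 0) =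
        M / m := by
      intro j hj
      rw [eq_div_iff hm.ne', mul_comm, mul_sum_colouring_eq (Finset.ne_of_mem_erase hj)]
    rw [Finset.sum_congr rfl hj]
    simp only [Finset.sum_const, Finset.card_univ, nsmul_eq_mul, mul_one]
    rw [← hM]
    have h1 : ((S.erase i).card : ℝ) ≤ m / 2 := by
      have : ((S.erase i).card : ℝ) ≤ S.card := by exact_mod_cast Finset.card_erase_le
      linarith
    have h2 : ((S.erase i).card : ℝ) * (M / m) ≤ m / 2 * (M / m) := by gcongr
    have h3 : (m : ℝ) / 2 * (M / m) = M / 2 := by field_simp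
    linarith
  refine le_trans (le_of_eq ?_) (Finset.sum_le_sum hi)
  simp
  ring

lemma sum_mul_card_le_of_isolated {a : Finset (Fin N) → ℝ} (ha : ∀ S, 0 ≤ a S) {B : ℝ}
    (h : ∀ κ : Fin N → ZMod m, ∑ S, a S * (isolated κ S).card ≤ B)
    {T : Finset (Finset (Fin N))} (hT : ∀ S ∈ T, 2 * S.card ≤ m) :
    ∑ S ∈ T, a S * (S.card / 2) ≤ B := by
  have hM : (0 : ℝ) < Fintype.card (Fin N → ZMod m) := Nat.cast_pos.mpr Fintype.card_pos
  refine le_of_mul_le_mul_left ?_ hM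
  calc (Fintype.card (Fin N → ZMod m) : ℝ) * ∑ S ∈ T, a S * (S.card / 2)
      = ∑ S ∈ T, a S * (Fintype.card (Fin N → ZMod m) * (S.card / 2)) := by
        rw [Finset.mul_sum]
        exact Finset.sum_congr rfl fun S _ => by ring
    _ ≤ ∑ S ∈ T, a S * ∑ κ : Fin N → ZMod m, ((isolated κ S).card : ℝ) :=
        Finset.sum_le_sum fun S hS =>
          mul_le_mul_of_nonneg_left (le_sum_card_isolated (hT S hS)) (ha S)
    _ ≤ ∑ S, a S * ∑ κ : Fin N → ZMod m, ((isolated κ S).card : ℝ) :=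
        Finset.sum_le_sum_of_subset_of_nonneg (Finset.subset_univ T) fun S _ _ =>
          mul_nonneg (ha S) (Finset.sum_nonneg fun κ _ => Nat.cast_nonneg _)
    _ = ∑ κ : Fin N → ZMod m, ∑ S, a S * (isolated κ S).card := by
        simp only [Finset.mul_sum]
        rw [Finset.sum_comm]
    _ ≤ ∑ κ : Fin N → ZMod m, B := Finset.sum_le_sum fun κ _ => h κ
    _ = _ := by simp

end RandomColouring

/-! ### Low and high Fourier levels -/

section Levels

variable {N : ℕ}

lemma sum_dyadic_level_le (f : (Fin N → Bool) → Bool) (j : ℕ) :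
    (∑ S with 2 ^ j ≤ S.card ∧ S.card < 2 ^ (j + 1), walshCoeff (centered f) S ^ 2) * √2 ^ j ≤
      4 * cubeE N (fun x => √(posSens f x)) := by
  have h := sum_mul_card_le_of_isolated (m := 2 ^ (j + 2)) (fun S => sq_nonneg _)
    (fun κ => sum_walshCoeff_sq_mul_card_isolated_le_posSens κ f)
    (T := Finset.univ.filter fun S => 2 ^ j ≤ S.card ∧ S.card < 2 ^ (j + 1))
    (fun S hS => by
      have := (Finset.mem_filter.mp hS).2.2
      rw [pow_succ 2 (j + 1)]
      omega)
  set E := cubeE N fun x => √(posSens f x)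
  set B := ∑ S with 2 ^ j ≤ S.card ∧ S.card < 2 ^ (j + 1), walshCoeff (centered f) S ^ 2 with hB
  set r := √2 ^ j with hr
  have hr0 : 0 < r := by positivity
  have h2 : r * r = 2 ^ j := by rw [hr, ← mul_pow, Real.mul_self_sqrt (by norm_num)]
  have hm : √((Fintype.card (ZMod (2 ^ (j + 2))) : ℕ) : ℝ) = 2 * r := by
    rw [ZMod.card, Real.sqrt_eq_iff_mul_self_eq (by positivity) (by positivity)]
    push_cast
    rw [pow_add, ← h2]
    ring
  rw [hm] at h
  have h3 : B * (2 ^ j / 2) ≤ 2 * r * E := by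
    refine le_trans ?_ h
    rw [hB, Finset.sum_mul]
    refine Finset.sum_le_sum fun S hS => ?_
    have : (2 : ℝ) ^ j ≤ S.card := by exact_mod_cast (Finset.mem_filter.mp hS).2.1
    gcongr
  rw [← h2] at h3
  nlinarith

lemma sum_high_levels_le (f : (Fin N → Bool) → Bool) (J : ℕ) :
    (∑ S with 2 ^ J ≤ S.card, walshCoeff (centered f) S ^ 2) * √2 ^ J ≤
      16 * cubeE N (fun x => √(posSens f x)) := by
  have hE : 0 ≤ cubeE N (fun x => √(posSens f x)) := cubeE_nonneg fun x => Real.sqrt_nonneg _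
  suffices H : ∀ k J, N ≤ J + k →
      (∑ S with 2 ^ J ≤ S.card, walshCoeff (centered f) S ^ 2) * √2 ^ J ≤
        16 * cubeE N (fun x => √(posSens f x)) from H N J (by omega)
  intro k
  induction k with
  | zero =>
    intro J hJ
    rw [Finset.filter_false_of_mem]
    · simpa using hE
    · intro S _
      have h1 : S.card ≤ N := by simpa using S.card_le_univ
      have h2 : N < 2 ^ J := lt_of_le_of_lt hJ Nat.lt_two_pow_self
      omega
  | succ k ih =>
    intro J hJ
    have h1 := ih (J + 1) (by omega)
    have h2 := sum_dyadic_level_le f J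
    have hsplit : ∑ S with 2 ^ J ≤ S.card, walshCoeff (centered f) S ^ 2 =
        (∑ S with 2 ^ J ≤ S.card ∧ S.card < 2 ^ (J + 1), walshCoeff (centered f) S ^ 2) +
        ∑ S with 2 ^ (J + 1) ≤ S.card, walshCoeff (centered f) S ^ 2 := by
      rw [← Finset.sum_filter_add_sum_filter_not _ fun S => S.card < 2 ^ (J + 1),
        Finset.filter_filter, Finset.filter_filter]
      congr 2
      ext S
      have : 2 ^ J ≤ 2 ^ (J + 1) := Nat.pow_le_pow_right (by norm_num) (by omega)
      simp only [Finset.mem_filter, Finset.mem_univ, true_and]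
      omega
    rw [hsplit, add_mul]
    rw [pow_succ √2, ← mul_assoc] at h1
    have hs : (4 : ℝ) / 3 ≤ √2 := Real.le_sqrt_of_sq_le (by norm_num)
    set W := (∑ S with 2 ^ (J + 1) ≤ S.card, walshCoeff (centered f) S ^ 2) * √2 ^ J
    have hW : 0 ≤ W := mul_nonneg (Finset.sum_nonneg fun S _ => sq_nonneg _) (by positivity)
    nlinarith

lemma sum_low_levels_le (f : (Fin N → Bool) → Bool) {d : ℕ} (hd : 0 < d)
    (h : 512 * (d : ℝ) * 81 ^ d * ∑ i, influence f i ^ 2 ≤ 1) :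
    ∑ S with 1 ≤ S.card ∧ S.card < d, walshCoeff (centered f) S ^ 2 ≤ bvar f / 2 := by
  have hV := bvar_nonneg f
  set V := bvar f with hVdef
  set δ := ∑ i, influence f i ^ 2 with hδ
  have hδ0 : 0 ≤ δ := Finset.sum_nonneg fun i _ => sq_nonneg _
  set T : Finset (Finset (Fin N)) := Finset.univ.filter fun S => 1 ≤ S.card ∧ S.card < d
  set w := ∑ S ∈ T, walshCoeff (centered f) S ^ 2 with hw
  set w' := ∑ S ∈ T, walshCoeff (centered f) S ^ 2 / 3 ^ S.card with hw'
  have hw0 : 0 ≤ w := Finset.sum_nonneg fun i _ => sq_nonneg _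
  have hw'0 : 0 ≤ w' := Finset.sum_nonneg fun i _ => by positivity
  have hww' : w ≤ 3 ^ d * w' := by
    rw [hw, hw', Finset.mul_sum]
    refine Finset.sum_le_sum fun S hS => ?_
    have : (3 : ℝ) ^ S.card ≤ 3 ^ d :=
      pow_le_pow_right₀ (by norm_num) (Finset.mem_filter.mp hS).2.2.le
    rw [mul_div_assoc', le_div_iff₀ (by positivity), mul_comm]
    gcongr
  have h1 : w' ≤ 2 * V * √V := by
    have := sum_walshCoeff_sq_div_le (centered f)
    rw [cubeE_abs_centered, ← bvar_eq] at this
    refine le_trans ?_ this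
    exact Finset.sum_le_sum_of_subset_of_nonneg (Finset.subset_univ T) fun S _ _ => by positivity
  have h2 : w' ≤ 2 * (√δ * √(2 * d * V)) := by
    have : NeZero (2 * d) := ⟨by omega⟩
    have := sum_mul_card_le_of_isolated (m := 2 * d) (T := T) (fun S => by positivity)
      (fun κ => sum_walshCoeff_sq_div_mul_card_isolated_le κ f)
      (fun S hS => by have := (Finset.mem_filter.mp hS).2.2; omega)
    rw [ZMod.card] at this
    push_cast at this
    have h3 : w' / 2 ≤ √δ * √(2 * d * V) := by
      refine le_trans ?_ this
      rw [hw', Finset.sum_div]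
      refine Finset.sum_le_sum fun S hS => ?_
      have : (1 : ℝ) ≤ S.card := by exact_mod_cast (Finset.mem_filter.mp hS).2.1
      rw [div_eq_mul_one_div _ (2 : ℝ)]
      gcongr
    linarith
  have hsmall : 16 * 9 ^ d * (√δ * √(2 * d)) ≤ 1 := by
    refine abs_le_of_sq_le_sq' ?_ zero_le_one |>.2
    rw [mul_pow, mul_pow √δ, Real.sq_sqrt hδ0, Real.sq_sqrt (by positivity), mul_pow, ← pow_mul,
      mul_comm d, pow_mul]
    norm_num
    linarith
  have h4 : w ^ 2 ≤ (V / 2) ^ 2 := by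
    calc w ^ 2 ≤ (3 ^ d * w') ^ 2 := by gcongr
      _ = 9 ^ d * (w' * w') := by
        rw [mul_pow, ← pow_mul, mul_comm d, pow_mul]; norm_num; ring
      _ ≤ 9 ^ d * ((2 * V * √V) * (2 * (√δ * √(2 * d * V)))) := by gcongr
      _ = (16 * 9 ^ d * (√δ * √(2 * d))) * (V * (√V * √V) / 4) := by
        rw [Real.sqrt_mul (by positivity : (0 : ℝ) ≤ 2 * d)]; ring
      _ ≤ 1 * (V * (√V * √V) / 4) := by gcongr
      _ = (V / 2) ^ 2 := by rw [Real.mul_self_sqrt hV]; ring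
  exact abs_le_of_sq_le_sq' h4 (by positivity) |>.2

lemma bvar_eq_low_add_high (f : (Fin N → Bool) → Bool) (d : ℕ) :
    bvar f = (∑ S with 1 ≤ S.card ∧ S.card < d, walshCoeff (centered f) S ^ 2) +
      ∑ S with d ≤ S.card, walshCoeff (centered f) S ^ 2 := by
  rw [bvar_eq, ← sum_walshCoeff_sq, ← Finset.sum_filter_add_sum_filter_not _ fun S => S.card < d]
  congr 1
  · rw [← Finset.sum_filter_add_sum_filter_not _ fun S => 1 ≤ S.card, Finset.filter_filter,
      Finset.filter_filter]
    rw [Finset.sum_eq_zero (s := Finset.univ.filter fun S : Finset (Fin N) =>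
      S.card < d ∧ ¬ 1 ≤ S.card)]
    · simp only [and_comm, add_zero]
    · intro S hS
      have : S = ∅ := by
        rw [← Finset.card_eq_zero]
        have := (Finset.mem_filter.mp hS).2.2
        omega
      rw [this, walshCoeff_empty, cubeE_centered]
      norm_num
  · simp only [not_lt]

lemma bvar_le_cubeE_sqrt_posSens (f : (Fin N → Bool) → Bool) :
    bvar f ≤ 16 * cubeE N (fun x => √(posSens f x)) := by
  rw [bvar_eq_low_add_high f 1]
  have h := sum_high_levels_le f 0
  have h0 : (Finset.univ.filter fun S : Finset (Fin N) => 1 ≤ S.card ∧ S.card < 1) = ∅ :=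
    Finset.filter_false_of_mem fun S _ => by omega
  rw [h0]
  simpa using h

lemma mul_pow_le_one_of_mul_exp_le {δ L : ℝ} {d : ℕ} (hd : 0 < d) (hδ : 0 ≤ δ)
    (hL : 16 * (d : ℝ) ≤ L) (h : δ * Real.exp L ≤ 2) : 512 * (d : ℝ) * 81 ^ d * δ ≤ 1 := by
  have h1 : (165888 : ℝ) ^ d ≤ Real.exp L := by
    have e1 : (165888 : ℝ) ≤ Real.exp 16 := by
      have e2 : Real.exp 16 = Real.exp 1 ^ 16 := by rw [← Real.exp_nat_mul]; norm_num
      rw [e2]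
      calc (165888 : ℝ) ≤ 2.7 ^ 16 := by norm_num
        _ ≤ Real.exp 1 ^ 16 := by gcongr; linarith [Real.exp_one_gt_d9]
    calc (165888 : ℝ) ^ d ≤ Real.exp 16 ^ d := by gcongr
      _ = Real.exp (16 * d) := by rw [← Real.exp_nat_mul, mul_comm]
      _ ≤ Real.exp L := Real.exp_le_exp.mpr hL
  have h2 : (d : ℝ) ≤ 2 ^ d := by exact_mod_cast Nat.lt_two_pow_self.le
  have h3 : (1024 : ℝ) ≤ 1024 ^ d := le_self_pow₀ (by norm_num) hd.ne'
  have h4 : 1024 * (d : ℝ) * 81 ^ d ≤ Real.exp L := by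
    refine le_trans ?_ h1
    calc 1024 * (d : ℝ) * 81 ^ d ≤ 1024 ^ d * 2 ^ d * 81 ^ d := by gcongr
      _ = 165888 ^ d := by rw [← mul_pow, ← mul_pow]; norm_num
  nlinarith [mul_le_mul_of_nonneg_right h4 hδ]

lemma bvar_mul_sqrt_le (f : (Fin N → Bool) → Bool) {L : ℝ}
    (h : (∑ i, influence f i ^ 2) * Real.exp L ≤ 2 ∨ L ≤ 16) :
    bvar f * √L ≤ 200 * cubeE N (fun x => √(posSens f x)) := by
  have hE : 0 ≤ cubeE N (fun x => √(posSens f x)) := cubeE_nonneg fun x => Real.sqrt_nonneg _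
  have hV := bvar_nonneg f
  by_cases hL : L ≤ 16
  · have h1 := bvar_le_cubeE_sqrt_posSens f
    have h2 : √L ≤ 4 := Real.sqrt_le_iff.mpr ⟨by norm_num, by linarith⟩
    nlinarith [mul_le_mul_of_nonneg_left h2 hV]
  · have h := h.resolve_right hL
    push Not at hL
    set n := ⌊L / 16⌋₊ with hn
    have hn0 : n ≠ 0 := by
      rw [hn, ← Nat.pos_iff_ne_zero, Nat.floor_pos]
      linarith
    set J := Nat.log 2 n
    have hlow : 16 * ((2 ^ J : ℕ) : ℝ) ≤ L := by
      have h1 : ((2 ^ J : ℕ) : ℝ) ≤ n := by exact_mod_cast Nat.pow_log_le_self 2 hn0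
      have h2 : (n : ℝ) ≤ L / 16 := Nat.floor_le (by linarith)
      linarith
    have hhigh : L ≤ 32 * 2 ^ J := by
      have h1 : n + 1 ≤ 2 ^ (J + 1) := Nat.lt_pow_succ_log_self (by norm_num) n
      have h2 : ((n + 1 : ℕ) : ℝ) ≤ ((2 ^ (J + 1) : ℕ) : ℝ) := by exact_mod_cast h1
      have h3 : L / 16 < n + 1 := Nat.lt_floor_add_one _
      push_cast at h2
      rw [pow_succ] at h2
      linarith
    have hd : 0 < 2 ^ J := by positivity
    have hw := sum_low_levels_le f hd (mul_pow_le_one_of_mul_exp_le hd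
      (Finset.sum_nonneg fun i _ => sq_nonneg _) hlow h)
    have hsplit := bvar_eq_low_add_high f (2 ^ J)
    have hW := sum_high_levels_le f J
    have h1 : bvar f / 2 * √2 ^ J ≤ 16 * cubeE N (fun x => √(posSens f x)) := by
      refine le_trans ?_ hW
      gcongr
      linarith
    have h2 : √L ≤ 6 * √2 ^ J := by
      refine Real.sqrt_le_iff.mpr ⟨by positivity, ?_⟩
      rw [mul_pow, ← pow_mul, mul_comm J, pow_mul, Real.sq_sqrt (by norm_num)]
      have : (0 : ℝ) < 2 ^ J := by positivity
      linarith
    nlinarith [mul_le_mul_of_nonneg_left h2 hV]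

end Levels

/-- Talagrand-type inequality. There is an absolute constant `c > 0` so
that for any `N ≥ 1` and any non-constant `f : {0,1}^N → {0,1}`,
`E[√(s_f⁺(x))] ≥ c · Var(f) · √(log(1 + 1/Σᵢ Iᵢ[f]²))`; in particular if
`Σᵢ Iᵢ[f]² ≤ N^{−1/4}` then `E[√(s_f⁺(x))] ≥ c · Var(f) · √(log N)`. -/
theorem talagrand_positive_sensitivity :
    ∃ c : ℝ, 0 < c ∧
      ∀ N : ℕ, 1 ≤ N → ∀ f : (Fin N → Bool) → Bool, (∃ x y, f x ≠ f y) →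
        (c * bvar f *
            Real.sqrt (Real.log (1 + 1 / ∑ i : Fin N, (influence f i) ^ 2))
          ≤ cubeE N (fun x => Real.sqrt (posSens f x))) ∧
        ((∑ i : Fin N, (influence f i) ^ 2) ≤ (N : ℝ) ^ (-(1 : ℝ) / 4) →
          c * bvar f * Real.sqrt (Real.log N)
            ≤ cubeE N (fun x => Real.sqrt (posSens f x))) := by
  refine ⟨1 / 400, by norm_num, fun N hN f _ => ?_⟩
  have hV := bvar_nonneg f
  set δ := ∑ i : Fin N, influence f i ^ 2 with hδ
  have hδ0 : 0 ≤ δ := Finset.sum_nonneg fun i _ => sq_nonneg _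
  constructor
  · have h := bvar_mul_sqrt_le f (L := Real.log (1 + 1 / δ)) <| by
      rw [Real.exp_log (by positivity), ← hδ]
      rcases le_or_gt δ 1 with h1 | h1
      · left
        rcases hδ0.eq_or_lt with h0 | h0
        · rw [← h0]; norm_num
        · rw [mul_add, mul_one_div_cancel h0.ne']; linarith
      · right
        have h2 : 1 / δ ≤ 1 := by rw [div_le_one (by linarith)]; exact h1.le
        have h3 := Real.log_le_sub_one_of_pos (show 0 < 1 + 1 / δ by positivity)
        linarith
    have h0 : 0 ≤ bvar f * √(Real.log (1 + 1 / δ)) := by positivity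
    linarith
  · intro hδN
    have hN0 : (0 : ℝ) < N := by exact_mod_cast hN
    have h := bvar_mul_sqrt_le f (L := Real.log N / 4) <| by
      left
      rw [← hδ, div_eq_mul_one_div, ← Real.rpow_def_of_pos hN0]
      calc δ * (N : ℝ) ^ ((1 : ℝ) / 4) ≤ (N : ℝ) ^ (-(1 : ℝ) / 4) * (N : ℝ) ^ ((1 : ℝ) / 4) := by
            gcongr
        _ = 1 := by rw [← Real.rpow_add hN0]; norm_num
        _ ≤ 2 := by norm_num
    have h4 : √(Real.log N / 4) = √(Real.log N) / 2 := by
      rw [Real.sqrt_div' _ (by norm_num), show (4 : ℝ) = 2 ^ 2 by norm_num,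
        Real.sqrt_sq (by norm_num)]
    rw [h4] at h
    linarith
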